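/- If m_B ≠ m_D, then the AC cylinder equals the image under the center map Ψ of the set {P ∈ Π : P_AC·P_AC = 1/2} of conformally inscribed parallelograms whose AC diagonal has squared length 1/2. -/

import Mathlib

noncomputable section

open Real Set

/-- Membership predicate for conformally inscribed parallelograms.
Coordinates of `P : Fin 9 → ℝ`:
`0 = x_A, 1 = y_A, 2 = x_B, 3 = y_B, 4 = x_C, 5 = y_C, 6 = x_D, 7 = y_D, 8 = w`.
The vertex `(x_L, y_L)` lies on the line `L(w)` for `L ∈ {A,B,C,D}` and the
midpoints of the two diagonals coincide. -/
def IsCIP (mA mB mC mD bA : ℝ) (P : Fin 9 → ℝ) : Prop :=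
  P 1 = mA * P 0 + bA * P 8 ∧
  P 3 = mB * P 2 + P 8 ∧
  P 5 = mC * P 4 ∧
  P 7 = mD * P 6 ∧
  P 0 + P 4 = P 2 + P 6 ∧
  P 1 + P 5 = P 3 + P 7

/-- `Π`, the set of conformally inscribed parallelograms. -/
def CIP (mA mB mC mD bA : ℝ) : Set (Fin 9 → ℝ) := {P | IsCIP mA mB mC mD bA P}

/-- The `AC` diagonal vector of a parallelogram. -/
def vAC (P : Fin 9 → ℝ) : ℝ × ℝ := (P 0 - P 4, P 1 - P 5)

/-- The `BD` diagonal vector of a parallelogram. -/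
def vBD (P : Fin 9 → ℝ) : ℝ × ℝ := (P 2 - P 6, P 3 - P 7)

/-- The `AB` side vector of a parallelogram. -/
def vAB (P : Fin 9 → ℝ) : ℝ × ℝ := (P 0 - P 2, P 1 - P 3)

/-- The `BC` side vector of a parallelogram. -/
def vBC (P : Fin 9 → ℝ) : ℝ × ℝ := (P 2 - P 4, P 3 - P 5)

/-- Dot product in `ℝ²`. -/
def dot2 (a b : ℝ × ℝ) : ℝ := a.1 * b.1 + a.2 * b.2

/-- The inner product `⟨P, Q⟩ = P_AC · Q_AC + P_BD · Q_BD` on `Π`. -/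
def pinner (P Q : Fin 9 → ℝ) : ℝ := dot2 (vAC P) (vAC Q) + dot2 (vBD P) (vBD Q)

/-- The center map `Ψ : Π → ℝ³`, sending `P` to its center together with its scale. -/
def centerMap (P : Fin 9 → ℝ) : ℝ × ℝ × ℝ := ((P 0 + P 4) / 2, (P 1 + P 5) / 2, P 8)

/-- The `AC` cylinder: the set of `(x, y, w) ∈ ℝ³` such that `(x, y)` is the
midpoint of a segment of squared length `1/2` joining `A(w)` and `C(w)`. -/
def ACcyl (mA bA mC : ℝ) : Set (ℝ × ℝ × ℝ) :=
  {v | ∃ xA yA xC yC : ℝ, yA = mA * xA + bA * v.2.2 ∧ yC = mC * xC ∧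
      2 * v.1 = xA + xC ∧ 2 * v.2.1 = yA + yC ∧
      (xA - xC) ^ 2 + (yA - yC) ^ 2 = 1 / 2}

/-- Lines of distinct slopes `mB`, `mD` contain points with any prescribed coordinate sums. -/
theorem exists_add_eq_of_slope_ne {mB mD : ℝ} (h : mB ≠ mD) (w s t : ℝ) :
    ∃ x x' : ℝ, x + x' = s ∧ (mB * x + w) + mD * x' = t := by
  have h' : mB - mD ≠ 0 := sub_ne_zero.mpr h
  refine ⟨(t - w - mD * s) / (mB - mD), s - (t - w - mD * s) / (mB - mD), by ring, ?_⟩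
  field_simp
  ring

theorem stmt_19 (mA mB mC mD bA : ℝ) (hCD : mC ≠ mD) (hBD : mB ≠ mD) :
    ACcyl mA bA mC =
      centerMap '' {P ∈ CIP mA mB mC mD bA | dot2 (vAC P) (vAC P) = 1 / 2} := by
  ext ⟨x, y, w⟩
  constructor
  · rintro ⟨xA, yA, xC, yC, hA, hC, hx, hy, hd⟩
    obtain ⟨xB, xD, hs, ht⟩ := exists_add_eq_of_slope_ne hBD w (xA + xC) (yA + yC)
    refine ⟨![xA, yA, xB, mB * xB + w, xC, yC, xD, mD * xD, w],
      ⟨⟨hA, rfl, hC, rfl, hs.symm, ht.symm⟩, ?_⟩, ?_⟩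
    · change (xA - xC) * (xA - xC) + (yA - yC) * (yA - yC) = 1 / 2
      linarith
    · change ((xA + xC) / 2, (yA + yC) / 2, w) = (x, y, w)
      rw [← hx, ← hy, mul_div_cancel_left₀ x two_ne_zero, mul_div_cancel_left₀ y two_ne_zero]
  · rintro ⟨P, ⟨⟨hA, -, hC, -, -, -⟩, hd⟩, hP⟩
    rw [← hP]
    refine ⟨P 0, P 1, P 4, P 5, hA, hC, mul_div_cancel₀ _ two_ne_zero,
      mul_div_cancel₀ _ two_ne_zero, ?_⟩
    simpa only [dot2, vAC, sq] using hd
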